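/- arXiv:1810.00993 — 2 statements merged into one kernel-verified Lean document; each statement's English description precedes it below -/
import Mathlib

section
/- For all n ≥ 4, p(n,3) = 4·E(n−1,3) − (C(n,3) − C(n,2) + 4)·2^{n−2} − 22·C(n,5) + 16·C(n,4) − 4·C(n,3) + 2n, where C(n,k) denotes the binomial coefficient. -/
open Finset
open scoped Classical

/-- The one-line word of a permutation of `Fin n`, with values in `{1, …, n}`. -/
def permWord {n : ℕ} (π : Equiv.Perm (Fin n)) : List ℕ :=
  (List.finRange n).map fun i => (π i : ℕ) + 1

/-- The set of (0-indexed) ascent positions of a word. Position `i` (for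
`0 ≤ i ≤ length - 2`) is an ascent if `w_i < w_{i+1}`. -/
def ascentSet (w : List ℕ) : Finset ℕ :=
  (Finset.range (w.length - 1)).filter fun i => w.getD i 0 < w.getD (i + 1) 0

/-- The set of (0-indexed) descent positions of a word. Position `i` (for
`0 ≤ i ≤ length - 2`) is a descent if `w_i > w_{i+1}`. -/
def descentSet (w : List ℕ) : Finset ℕ :=
  (Finset.range (w.length - 1)).filter fun i => w.getD (i + 1) 0 < w.getD i 0

/-- The number of descents of a permutation. -/
def descentCount {n : ℕ} (π : Equiv.Perm (Fin n)) : ℕ :=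
  (descentSet (permWord π)).card

/-- A permutation is ballot if every prefix of its one-line notation has at least
as many ascents as descents. -/
def IsBallot {n : ℕ} (π : Equiv.Perm (Fin n)) : Prop :=
  ∀ k, k ≤ n →
    (descentSet ((permWord π).take k)).card ≤ (ascentSet ((permWord π).take k)).card

/-- The Eulerian number `E(n,d)`: the number of permutations of `{1,…,n}` with
exactly `d` descents.  (`E(0,0) = 1` and `E(0,d) = 0` for `d ≥ 1`.) -/
noncomputable def eulerianNum (n d : ℕ) : ℕ :=
  (Finset.univ.filter fun π : Equiv.Perm (Fin n) => descentCount π = d).card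

/-- `M(c)` for a cycle `c`: the minimum of the number of cyclic ascents and the
number of cyclic descents of `c`. -/
noncomputable def cycleM {n : ℕ} (c : Equiv.Perm (Fin n)) : ℕ :=
  min ((c.support.filter fun x => x < c x).card) ((c.support.filter fun x => c x < x).card)

/-- `M(π)`: the sum of `M(c)` over the cycles `c` of the cycle decomposition of `π`
(fixed points contribute `0`). -/
noncomputable def permM {n : ℕ} (π : Equiv.Perm (Fin n)) : ℕ :=
  ∑ c ∈ π.cycleFactorsFinset, cycleM c

/-- The number of ballot permutations of `{1,…,n}`. -/
noncomputable def ballotTotal (n : ℕ) : ℕ :=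
  (Finset.univ.filter fun π : Equiv.Perm (Fin n) => IsBallot π).card

/-- The number of permutations of `{1,…,n}` of odd order. -/
noncomputable def oddOrderTotal (n : ℕ) : ℕ :=
  (Finset.univ.filter fun π : Equiv.Perm (Fin n) => Odd (orderOf π)).card

/-- `b(n,d)`: the number of ballot permutations of `{1,…,n}` with exactly `d` descents. -/
noncomputable def bCount (n d : ℕ) : ℕ :=
  (Finset.univ.filter fun π : Equiv.Perm (Fin n) => IsBallot π ∧ descentCount π = d).card

/-- `p(n,d)`: the number of odd order permutations `π` of `{1,…,n}` with `M(π) = d`. -/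
noncomputable def pCount (n d : ℕ) : ℕ :=
  (Finset.univ.filter fun π : Equiv.Perm (Fin n) => Odd (orderOf π) ∧ permM π = d).card

/-- The Eulerian–Catalan numbers: `EC(n) = 2·E(2n, n-1)`, with `EC(0) = 1`. -/
noncomputable def eulerianCatalan (n : ℕ) : ℕ :=
  if n = 0 then 1 else 2 * eulerianNum (2 * n) (n - 1)

/-- The number of descents of a word over a linear order. -/
def wordDescents {α : Type*} [LinearOrder α] : List α → ℕ
  | [] => 0
  | [_] => 0
  | a :: b :: l => (if b < a then 1 else 0) + wordDescents (b :: l)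

/-- The Eulerian numbers, defined by their triangular recurrence. -/
def eulerianRec : ℕ → ℕ → ℤ
  | 0, 0 => 1
  | 0, _ + 1 => 0
  | n + 1, 0 => eulerianRec n 0
  | n + 1, d + 1 => (d + 2) * eulerianRec n (d + 1) + (n - d) * eulerianRec n d

theorem sum_wordDescents_permutations'Aux {α : Type*} [LinearOrder α] (t : α) (w : List α)
    (ht : ∀ y ∈ w, y < t) (f : ℕ → ℤ) :
    ((w.permutations'Aux t).map fun v => f (wordDescents v)).sum =
      (wordDescents w + 1) * f (wordDescents w)
        + (w.length - wordDescents w) * f (wordDescents w + 1) := by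
  induction w generalizing f with
  | nil => simp [wordDescents]
  | cons y u ih =>
    obtain ⟨hy, hu⟩ := List.forall_mem_cons.1 ht
    rcases u with _ | ⟨z, u⟩
    · simp [wordDescents, hy, hy.not_gt]
      ring
    · have hz : z < t := hu z (by simp)
      have key := ih hu fun k => f ((if z < y then 1 else 0) + k)
      simp only [List.permutations'Aux, List.map_cons, List.map_map, List.sum_cons,
        Function.comp_def, wordDescents, hy, hy.not_gt, hz, if_true, if_false,
        List.length_cons] at key ⊢
      split_ifs at key ⊢ with h
      · simp only [zero_add, Nat.cast_add, Nat.cast_one,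
          add_comm 1 (_ : ℕ), add_assoc] at key ⊢
        linear_combination key
      · simp only [zero_add, Nat.cast_add, Nat.cast_one,
          add_comm 1 (_ : ℕ)] at key ⊢
        linear_combination key

theorem sum_wordDescents_permutations' {α : Type*} [LinearOrder α] (l : List α)
    (hl : l.Pairwise (· > ·)) (d : ℕ) :
    (l.permutations'.map fun v => if wordDescents v = d then (1 : ℤ) else 0).sum =
      eulerianRec l.length d := by
  induction l generalizing d with
  | nil => cases d <;> simp [wordDescents, eulerianRec]
  | cons t l ih =>
    obtain ⟨ht, hl⟩ := List.pairwise_cons.1 hl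
    have step : ((t :: l).permutations'.map fun v => if wordDescents v = d then (1 : ℤ) else 0).sum
        = (l.permutations'.map fun w =>
            ((wordDescents w + 1) * (if wordDescents w = d then (1 : ℤ) else 0)
              + (l.length - wordDescents w) * (if wordDescents w + 1 = d then 1 else 0))).sum := by
      rw [List.permutations', List.map_flatMap, List.flatMap_def, List.sum_flatten, List.map_map]
      congr 1
      refine List.map_congr_left fun w hw => ?_
      have hw := List.mem_permutations'.1 hw
      rw [← hw.length_eq]
      exact sum_wordDescents_permutations'Aux t w (fun y hy => ht y (hw.mem_iff.1 hy))
        fun k => if k = d then 1 else 0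
    rw [step]
    cases d with
    | zero =>
      rw [List.length_cons, eulerianRec, ← ih hl]
      congr 1
      refine List.map_congr_left fun w _ => ?_
      split_ifs with h <;> simp_all
    | succ d =>
      rw [List.length_cons, eulerianRec, ← ih hl, ← ih hl, ← List.sum_map_mul_left,
        ← List.sum_map_mul_left, ← List.sum_map_add]
      congr 1
      refine List.map_congr_left fun w _ => ?_
      by_cases h : wordDescents w = d + 1
      · simp [h]
        ring
      · by_cases h' : wordDescents w = d
        · simp [h']
        · simp [h, h']

theorem nodup_permutations'_of_nodup {α : Type*} {l : List α} (hl : l.Nodup) :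
    l.permutations'.Nodup :=
  (List.permutations_perm_permutations' l).nodup_iff.1 (List.nodup_permutations l hl)

theorem card_filter_wordDescents {α : Type*} [LinearOrder α] (l : List α)
    (hl : l.Pairwise (· > ·)) (d : ℕ) :
    ((l.permutations'.toFinset.filter fun v => wordDescents v = d).card : ℤ) =
      eulerianRec l.length d := by
  have hnd : l.permutations'.Nodup :=
    nodup_permutations'_of_nodup (hl.imp fun h => h.ne')
  rw [← sum_wordDescents_permutations' l hl d, Finset.card_filter]
  push_cast
  rw [List.sum_toFinset _ hnd]

theorem card_descentSet (w : List ℕ) : (descentSet w).card = wordDescents w := by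
  induction w with
  | nil => simp [descentSet, wordDescents]
  | cons a w ih =>
    rcases w with _ | ⟨b, w⟩
    · simp [descentSet, wordDescents]
    · rw [wordDescents, ← ih]
      simp only [descentSet, Finset.card_filter, List.length_cons, Nat.add_sub_cancel,
        Finset.sum_range_succ' _ w.length, List.getD_cons_succ, List.getD_cons_zero]
      rw [add_comm]

theorem eulerianNum_eq_eulerianRec (n d : ℕ) : (eulerianNum n d : ℤ) = eulerianRec n d := by
  set l : List ℕ := ((List.finRange n).map fun i : Fin n => (i : ℕ) + 1).reverse with hldef
  have hlen : l.length = n := by simp [hldef]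
  have hl : l.Pairwise (· > ·) := by
    rw [hldef, List.pairwise_reverse, List.pairwise_map]
    exact (List.pairwise_lt_finRange n).imp fun h => by simpa using h
  have hnd : l.Nodup := hl.imp fun h => h.ne'
  have hinj : Function.Injective (permWord (n := n)) := fun π σ h => by
    ext i
    have := List.map_inj_left.1 h i (List.mem_finRange i)
    omega
  have himage : (univ : Finset (Equiv.Perm (Fin n))).image permWord = l.permutations'.toFinset := by
    apply Finset.eq_of_subset_of_card_le
    · intro w hw
      obtain ⟨π, -, rfl⟩ := Finset.mem_image.1 hw
      rw [List.mem_toFinset, List.mem_permutations']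
      refine List.Perm.trans ?_ (List.reverse_perm _).symm
      have := (Equiv.Perm.map_finRange_perm π).map fun i : Fin n => (i : ℕ) + 1
      simpa [permWord, Function.comp_def] using this
    · rw [Finset.card_image_of_injective _ hinj, Finset.card_univ, Fintype.card_perm,
        Fintype.card_fin, List.toFinset_card_of_nodup (nodup_permutations'_of_nodup hnd),
        ← (List.permutations_perm_permutations' l).length_eq, List.length_permutations, hlen]
  rw [← hlen, ← card_filter_wordDescents l hl d, ← himage, Finset.filter_image,
    Finset.card_image_of_injective _ hinj, eulerianNum, hlen]
  simp only [descentCount, card_descentSet]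

theorem eulerianRec_zero (n : ℕ) : eulerianRec n 0 = 1 := by
  induction n with
  | zero => rfl
  | succ n ih => rw [eulerianRec, ih]

theorem eulerianRec_one (n : ℕ) : eulerianRec n 1 = 2 ^ n - n - 1 := by
  induction n with
  | zero => rfl
  | succ n ih =>
    rw [eulerianRec, ih, eulerianRec_zero]
    push_cast
    ring

theorem eulerianRec_two (n : ℕ) :
    (eulerianRec n 2 : ℚ) = 3 ^ n - (n + 1) * 2 ^ n + n * (n + 1) / 2 := by
  induction n with
  | zero => norm_num [eulerianRec]
  | succ n ih =>
    rw [eulerianRec, eulerianRec_one]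
    push_cast
    rw [ih]
    ring

theorem eulerianRec_three (n : ℕ) :
    (eulerianRec n 3 : ℚ) =
      4 ^ n - (n + 1) * 3 ^ n + n * (n + 1) / 2 * 2 ^ n - (n - 1) * n * (n + 1) / 6 := by
  induction n with
  | zero => norm_num [eulerianRec]
  | succ n ih =>
    rw [eulerianRec]
    push_cast
    rw [ih, eulerianRec_two]
    ring

theorem sum_ite_apply_lt_eq_wordDescents {α : Type*} [LinearOrder α] (g : α → α) (a : α)
    (l : List α) (hchain : (a :: l).IsChain fun x y => g x = y)
    (hlast : ¬ g ((a :: l).getLast (List.cons_ne_nil a l)) <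
      (a :: l).getLast (List.cons_ne_nil a l)) :
    ((a :: l).map fun x => if g x < x then 1 else 0).sum = wordDescents (a :: l) := by
  induction l generalizing a with
  | nil => simpa [wordDescents] using hlast
  | cons b l ih =>
    obtain ⟨hab, hchain⟩ := List.isChain_cons_cons.1 hchain
    rw [List.map_cons, List.sum_cons, wordDescents, ih b hchain (by simpa using hlast), hab]

theorem card_descents_formPerm {N : ℕ} (m : Fin N) (w : List (Fin N)) (hw : w ≠ [])
    (hnd : (m :: w).Nodup) (hlt : ∀ x ∈ w, x < m) :
    ((m :: w).formPerm.support.filter fun x => (m :: w).formPerm x < x).card =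
      wordDescents w + 1 := by
  have hsupp : (m :: w).formPerm.support = (m :: w).toFinset :=
    List.support_formPerm_of_nodup _ hnd fun x hx => hw (by simp_all)
  rw [hsupp, Finset.card_filter, List.sum_toFinset _ hnd,
    sum_ite_apply_lt_eq_wordDescents]
  · obtain ⟨b, l, rfl⟩ := List.exists_cons_of_ne_nil hw
    rw [wordDescents, if_pos (hlt b (by simp)), add_comm]
  · rw [List.isChain_iff_getElem]
    intro i hi
    exact List.formPerm_apply_lt_getElem _ hnd i hi
  · rw [List.formPerm_apply_getLast, not_lt, List.getLast_cons hw]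
    exact (hlt _ (List.getLast_mem hw)).le

theorem card_cycles_descents {N : ℕ} (m : Fin N) (U : Finset (Fin N)) (hU : U.Nonempty)
    (hlt : ∀ x ∈ U, x < m) (d : ℕ) :
    ((univ.filter fun c : Equiv.Perm (Fin N) => (c.IsCycle ∧ c.support = insert m U) ∧
      (c.support.filter fun x => c x < x).card = d + 1).card : ℤ) = eulerianRec U.card d := by
  have hl : (U.sort (· ≥ ·)).Pairwise (· > ·) := U.sortedGT_sort.pairwise
  rw [← Finset.length_sort (· ≥ ·) (s := U), ← card_filter_wordDescents _ hl d]
  have hword : ∀ w ∈ (U.sort (· ≥ ·)).permutations'.toFinset,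
      w ≠ [] ∧ (m :: w).Nodup ∧ (∀ x ∈ w, x < m) ∧ ∀ x, x ∈ w ↔ x ∈ U := by
    intro w hw
    rw [List.mem_toFinset, List.mem_permutations'] at hw
    have hmem : ∀ x, x ∈ w ↔ x ∈ U := fun x => by rw [hw.mem_iff, Finset.mem_sort]
    refine ⟨?_, ?_, fun x hx => hlt x ((hmem x).1 hx), hmem⟩
    · rintro rfl
      obtain ⟨x, hx⟩ := hU
      simpa using (hmem x).2 hx
    · refine List.nodup_cons.2 ⟨fun h => (hlt m ((hmem m).1 h)).false, ?_⟩
      exact hw.nodup_iff.2 (Finset.sort_nodup _ _)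
  have htwo : ∀ w : List (Fin N), w ≠ [] → 2 ≤ (m :: w).length := fun w hw => by
    have := List.length_pos_of_ne_nil hw
    simp only [List.length_cons]
    omega
  norm_cast
  symm
  refine Finset.card_nbij (fun w => (m :: w).formPerm) ?_ ?_ ?_
  · intro w hw
    obtain ⟨hw, hd⟩ := Finset.mem_filter.1 hw
    obtain ⟨hne, hnd, hm, hmem⟩ := hword w hw
    simp only [Finset.coe_filter, Finset.mem_univ, true_and, Set.mem_ofPred_eq]
    refine ⟨⟨List.isCycle_formPerm hnd (htwo w hne), ?_⟩, ?_⟩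
    · rw [List.support_formPerm_of_nodup _ hnd fun x hx => hne (by simp_all)]
      ext x
      simp [hmem]
    · rw [card_descents_formPerm m w hne hnd hm, hd]
  · intro w hw v hv h
    obtain ⟨hne, hnd, -⟩ := hword w (Finset.mem_filter.1 hw).1
    obtain ⟨hne', hnd', -⟩ := hword v (Finset.mem_filter.1 hv).1
    have h1 := Equiv.Perm.toList_formPerm_nontrivial _ (htwo w hne) hnd
    have h2 := Equiv.Perm.toList_formPerm_nontrivial _ (htwo v hne') hnd'
    simp only [List.get_eq_getElem, List.getElem_cons_zero] at h1 h2 h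
    rw [h, h2] at h1
    simpa using h1.symm
  · intro c hc
    simp only [Finset.coe_filter, Finset.mem_univ, true_and, Set.mem_ofPred_eq] at hc
    obtain ⟨⟨hc, hs⟩, hd⟩ := hc
    have hm : m ∈ c.support := by simp [hs]
    obtain ⟨a, w, haw⟩ := List.exists_cons_of_ne_nil
      (mt Equiv.Perm.toList_eq_nil_iff.1 (not_not.2 hm))
    have ha : a = m := by
      have := Equiv.Perm.toList_getElem_zero c m hm
      simpa [haw] using this
    subst ha
    have hnd := Equiv.Perm.nodup_toList c a
    have hform := Equiv.Perm.formPerm_toList c a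
    rw [hc.cycleOf_eq (Equiv.Perm.mem_support.1 hm), haw] at hform
    rw [haw] at hnd
    have hmem : w ∈ (U.sort (· ≥ ·)).permutations'.toFinset := by
      rw [List.mem_toFinset, List.mem_permutations',
        List.perm_ext_iff_of_nodup (List.nodup_cons.1 hnd).2 (Finset.sort_nodup _ _)]
      intro x
      rw [Finset.mem_sort]
      have haU : a ∉ U := fun h => (hlt a h).false
      by_cases hx : x = a
      · subst hx
        simp [haU, (List.nodup_cons.1 hnd).1]
      · have h1 : x ∈ c.toList a ↔ x ∈ c.support := by
          rw [Equiv.Perm.mem_toList_iff, and_iff_left hm]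
          constructor
          · exact fun h => Equiv.Perm.mem_support.2
              (mt h.apply_eq_self_iff.2 (Equiv.Perm.mem_support.1 hm))
          · exact fun h => hc.sameCycle (Equiv.Perm.mem_support.1 hm) (Equiv.Perm.mem_support.1 h)
        simpa [haw, hs, hx] using h1
    refine ⟨w, ?_, hform⟩
    simp only [Finset.coe_filter, Set.mem_ofPred_eq]
    refine ⟨hmem, ?_⟩
    obtain ⟨hne, -, hlt', -⟩ := hword w hmem
    have := card_descents_formPerm a w hne hnd hlt'
    rw [hform, hd] at this
    omega

theorem card_descents_inv {N : ℕ} (c : Equiv.Perm (Fin N)) :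
    (c⁻¹.support.filter fun x => c⁻¹ x < x).card = (c.support.filter fun x => x < c x).card := by
  refine Finset.card_bij' (fun x _ => c⁻¹ x) (fun x _ => c x) ?_ ?_ ?_ ?_
  · intro x hx
    have := (Finset.mem_filter.1 hx).2
    exact Finset.mem_filter.2 ⟨by simpa [eq_comm] using this.ne', by simpa using this⟩
  · intro x hx
    have := (Finset.mem_filter.1 hx).2
    exact Finset.mem_filter.2 ⟨by simpa [eq_comm] using this.ne', by simpa using this⟩
  · simp
  · simp

theorem card_cycles_ascents {N : ℕ} (m : Fin N) (U : Finset (Fin N)) (hU : U.Nonempty)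
    (hlt : ∀ x ∈ U, x < m) (d : ℕ) :
    ((univ.filter fun c : Equiv.Perm (Fin N) => (c.IsCycle ∧ c.support = insert m U) ∧
      (c.support.filter fun x => x < c x).card = d + 1).card : ℤ) = eulerianRec U.card d := by
  rw [← card_cycles_descents m U hU hlt d]
  norm_cast
  refine Finset.card_bij' (fun c _ => c⁻¹) (fun c _ => c⁻¹) ?_ ?_ ?_ ?_
  · intro c hc
    obtain ⟨-, ⟨hc, hs⟩, hd⟩ := Finset.mem_filter.1 hc
    refine Finset.mem_filter.2 ⟨mem_univ _, ⟨hc.inv, ?_⟩, by rw [card_descents_inv, hd]⟩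
    rw [Equiv.Perm.support_inv, hs]
  · intro c hc
    obtain ⟨-, ⟨hc, hs⟩, hd⟩ := Finset.mem_filter.1 hc
    refine Finset.mem_filter.2 ⟨mem_univ _, ⟨hc.inv, ?_⟩, ?_⟩
    · rw [Equiv.Perm.support_inv, hs]
    · rw [← card_descents_inv, inv_inv, hd]
  · simp
  · simp

theorem card_ascents_add_card_descents {N : ℕ} (c : Equiv.Perm (Fin N)) :
    (c.support.filter fun x => x < c x).card + (c.support.filter fun x => c x < x).card =
      c.support.card := by
  rw [← Finset.card_filter_add_card_filter_not (s := c.support) (fun x => x < c x)]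
  congr 2
  refine Finset.filter_congr fun x hx => ?_
  rw [not_lt, (Equiv.Perm.mem_support.1 hx).le_iff_lt]

theorem cycleM_pos {N : ℕ} {c : Equiv.Perm (Fin N)} (hc : c ≠ 1) : 0 < cycleM c := by
  have hs : c.support.Nonempty := by
    rwa [Finset.nonempty_iff_ne_empty, Ne, Equiv.Perm.support_eq_empty_iff]
  rw [cycleM, lt_min_iff, Finset.card_pos, Finset.card_pos]
  constructor
  · refine ⟨c.support.min' hs, Finset.mem_filter.2 ⟨Finset.min'_mem _ hs, ?_⟩⟩
    have hmem := Finset.min'_mem _ hs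
    exact lt_of_le_of_ne (Finset.min'_le _ _ (Equiv.Perm.apply_mem_support.2 hmem))
      (Equiv.Perm.mem_support.1 hmem).symm
  · refine ⟨c.support.max' hs, Finset.mem_filter.2 ⟨Finset.max'_mem _ hs, ?_⟩⟩
    have hmem := Finset.max'_mem _ hs
    exact lt_of_le_of_ne (Finset.le_max' _ _ (Equiv.Perm.apply_mem_support.2 hmem))
      (Equiv.Perm.mem_support.1 hmem)

/-- The number of odd cycles `c` (a fixed point being a cycle of length one) through all points of
a set of size `k` such that `M(c) = e`. -/
def oddCycleCount (k e : ℕ) : ℤ :=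
  if Odd k then
    if e = 0 then if k = 1 then 1 else 0
    else if 2 * e < k then 2 * eulerianRec (k - 1) (e - 1) else 0
  else 0

theorem card_cycles_cycleM {N : ℕ} (m : Fin N) (U : Finset (Fin N)) (hU : U.Nonempty)
    (hlt : ∀ x ∈ U, x < m) (hodd : Odd (U.card + 1)) (e : ℕ) :
    ((univ.filter fun c : Equiv.Perm (Fin N) => (c.IsCycle ∧ c.support = insert m U) ∧
      cycleM c = e).card : ℤ) = oddCycleCount (U.card + 1) e := by
  have hcard : (insert m U).card = U.card + 1 :=
    Finset.card_insert_of_notMem fun h => (hlt m h).false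
  have hpos := hU.card_pos
  rw [oddCycleCount, if_pos hodd]
  obtain ⟨r, hr⟩ := hodd
  split_ifs with he h1 hlt'
  · omega
  · rw [Finset.filter_false_of_mem, Finset.card_empty, Nat.cast_zero]
    rintro c - ⟨⟨hc, -⟩, hM⟩
    exact (cycleM_pos hc.ne_one).ne' (hM.trans he)
  · obtain ⟨d, rfl⟩ := Nat.exists_eq_succ_of_ne_zero he
    rw [Nat.succ_eq_add_one, Nat.add_sub_cancel, Nat.add_sub_cancel, two_mul]
    nth_rewrite 1 [← card_cycles_ascents m U hU hlt d]
    rw [← card_cycles_descents m U hU hlt d]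
    norm_cast
    rw [← Finset.card_union_of_disjoint, ← Finset.filter_or]
    · congr 1
      refine Finset.filter_congr fun c _ => ?_
      rw [← and_or_left, and_congr_right_iff]
      rintro ⟨-, hs⟩
      have := card_ascents_add_card_descents c
      rw [cycleM]
      rw [hs, hcard] at this
      rw [hs]
      omega
    · refine Finset.disjoint_filter.2 fun c _ h h' => ?_
      have := card_ascents_add_card_descents c
      rw [h.2, h'.2, h.1.2, hcard] at this
      omega
  · rw [Finset.filter_false_of_mem, Finset.card_empty, Nat.cast_zero]
    rintro c - ⟨⟨-, hs⟩, hM⟩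
    have := card_ascents_add_card_descents c
    rw [cycleM] at hM
    rw [hs, hcard] at this
    rw [hs] at hM
    omega

theorem permM_mul_of_disjoint {N : ℕ} {c σ : Equiv.Perm (Fin N)} (h : c.Disjoint σ) :
    permM (c * σ) = permM c + permM σ := by
  rw [permM, h.cycleFactorsFinset_mul_eq_union, Finset.sum_union h.disjoint_cycleFactorsFinset]
  rfl

theorem odd_orderOf_mul_of_disjoint {N : ℕ} {c σ : Equiv.Perm (Fin N)}
    (h : c.Disjoint σ) : Odd (orderOf (c * σ)) ↔ Odd (orderOf c) ∧ Odd (orderOf σ) := by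
  rw [h.orderOf]
  refine ⟨fun ho => ⟨ho.of_dvd_nat (Nat.dvd_lcm_left _ _), ho.of_dvd_nat (Nat.dvd_lcm_right _ _)⟩,
    fun ho => (ho.1.mul ho.2).of_dvd_nat (Nat.lcm_dvd_mul _ _)⟩

/-- The odd order permutations `π` supported in `S` with `M(π) = d`. -/
noncomputable def oddPerms {N : ℕ} (S : Finset (Fin N)) (d : ℕ) : Finset (Equiv.Perm (Fin N)) :=
  univ.filter fun π => π.support ⊆ S ∧ Odd (orderOf π) ∧ permM π = d

/-- The odd cycles `c` with `M(c) = e` whose points are `m` and the elements of `U`. The identity is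
regarded as a cycle through `m` alone. -/
noncomputable def oddCyclesThrough {N : ℕ} (m : Fin N) (U : Finset (Fin N)) (e : ℕ) :
    Finset (Equiv.Perm (Fin N)) :=
  univ.filter fun c => c.cycleOf m = c ∧ c.support.erase m = U ∧ Odd (orderOf c) ∧ permM c = e

theorem disjoint_cycleOf_inv_mul {N : ℕ} (π : Equiv.Perm (Fin N)) (m : Fin N) :
    (π.cycleOf m).Disjoint ((π.cycleOf m)⁻¹ * π) := by
  intro x
  by_cases hx : π.SameCycle m x
  · right
    rw [Equiv.Perm.mul_apply, Equiv.Perm.inv_eq_iff_eq, hx.cycleOf_apply]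
  · exact Or.inl (Equiv.Perm.cycleOf_apply_of_not_sameCycle hx)

theorem cycleOf_cycleOf_self {N : ℕ} (π : Equiv.Perm (Fin N)) (m : Fin N) :
    (π.cycleOf m).cycleOf m = π.cycleOf m := by
  by_cases hm : π m = m
  · rw [(Equiv.Perm.cycleOf_eq_one_iff π).2 hm, Equiv.Perm.cycleOf_one]
  · exact (Equiv.Perm.isCycle_cycleOf π hm).cycleOf_eq (by simpa using hm)

theorem disjoint_of_support_subset_sdiff {N : ℕ} {m : Fin N} {T : Finset (Fin N)} (hm : m ∉ T)
    {c σ : Equiv.Perm (Fin N)} (hσ : σ.support ⊆ T \ c.support.erase m) : c.Disjoint σ := by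
  rw [Equiv.Perm.disjoint_iff_disjoint_support, Finset.disjoint_left]
  intro x hxc hxσ
  obtain ⟨hxT, hx⟩ := Finset.mem_sdiff.1 (hσ hxσ)
  exact hx (Finset.mem_erase.2 ⟨fun h => hm (h ▸ hxT), hxc⟩)

theorem card_oddPerms_insert {N : ℕ} (m : Fin N) (T : Finset (Fin N)) (hm : m ∉ T) (d : ℕ) :
    (oddPerms (insert m T) d).card = ∑ U ∈ T.powerset, ∑ ij ∈ antidiagonal d,
      (oddCyclesThrough m U ij.1).card * (oddPerms (T \ U) ij.2).card := by
  simp only [← Finset.card_product]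
  rw [← Finset.sum_product', ← Finset.card_sigma]
  refine Finset.card_bij'
    (fun π _ => ⟨((π.cycleOf m).support.erase m,
        (permM (π.cycleOf m), permM ((π.cycleOf m)⁻¹ * π))),
      (π.cycleOf m, (π.cycleOf m)⁻¹ * π)⟩)
    (fun x _ => x.2.1 * x.2.2) ?_ ?_ ?_ ?_
  · intro π hπ
    obtain ⟨hs, ho, hd⟩ := (Finset.mem_filter.1 hπ).2
    have hdisj := disjoint_cycleOf_inv_mul π m
    have hmul : π.cycleOf m * ((π.cycleOf m)⁻¹ * π) = π := mul_inv_cancel_left _ _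
    rw [← hmul, odd_orderOf_mul_of_disjoint hdisj] at ho
    rw [← hmul, permM_mul_of_disjoint hdisj] at hd
    have hfix : ((π.cycleOf m)⁻¹ * π) m = m := by
      rw [Equiv.Perm.mul_apply, Equiv.Perm.inv_eq_iff_eq, Equiv.Perm.cycleOf_apply_self]
    have hsub : ((π.cycleOf m)⁻¹ * π).support ⊆ π.support := by
      have := hdisj.support_mul
      rw [hmul] at this
      exact this ▸ Finset.subset_union_right
    simp only [Finset.mem_sigma, Finset.mem_product, Finset.mem_powerset,
      Finset.HasAntidiagonal.mem_antidiagonal, oddCyclesThrough, oddPerms, Finset.mem_filter, Finset.mem_univ,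
      true_and, and_true]
    refine ⟨⟨?_, hd⟩, ⟨cycleOf_cycleOf_self π m, ho.1⟩, ?_, ho.2⟩
    · intro x hx
      obtain ⟨hxm, hx⟩ := Finset.mem_erase.1 hx
      exact (Finset.mem_insert.1 (hs (Equiv.Perm.support_cycleOf_le π m hx))).resolve_left hxm
    · intro x hx
      have hxm : x ≠ m := by
        rintro rfl
        exact Equiv.Perm.mem_support.1 hx hfix
      refine Finset.mem_sdiff.2 ⟨(Finset.mem_insert.1 (hs (hsub hx))).resolve_left hxm, fun h => ?_⟩
      exact hdisj.mem_imp (Finset.mem_of_mem_erase h) hx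
  · rintro ⟨⟨U, i, j⟩, c, σ⟩ hx
    simp only [Finset.mem_sigma, Finset.mem_product, Finset.mem_powerset,
      Finset.HasAntidiagonal.mem_antidiagonal, oddCyclesThrough, oddPerms, Finset.mem_filter, Finset.mem_univ,
      true_and] at hx
    obtain ⟨⟨hU, rfl⟩, ⟨hc, rfl, hco, rfl⟩, hσ, hσo, rfl⟩ := hx
    have hdisj := disjoint_of_support_subset_sdiff hm hσ
    refine Finset.mem_filter.2 ⟨mem_univ _, ?_, (odd_orderOf_mul_of_disjoint hdisj).2 ⟨hco, hσo⟩,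
      permM_mul_of_disjoint hdisj⟩
    rw [hdisj.support_mul]
    refine Finset.union_subset ?_ ((hσ.trans Finset.sdiff_subset).trans (Finset.subset_insert _ _))
    intro x hx
    by_cases hxm : x = m
    · simp [hxm]
    · exact Finset.mem_insert_of_mem (hU (Finset.mem_erase.2 ⟨hxm, hx⟩))
  · intro π _
    exact mul_inv_cancel_left _ _
  · rintro ⟨⟨U, i, j⟩, c, σ⟩ hx
    simp only [Finset.mem_sigma, Finset.mem_product, Finset.mem_powerset,
      Finset.HasAntidiagonal.mem_antidiagonal, oddCyclesThrough, oddPerms, Finset.mem_filter, Finset.mem_univ,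
      true_and] at hx
    obtain ⟨⟨-, rfl⟩, ⟨hc, rfl, -, rfl⟩, hσ, -, rfl⟩ := hx
    have hdisj := disjoint_of_support_subset_sdiff hm hσ
    have hmσ : σ m = m := by
      by_contra h
      exact hm (Finset.mem_sdiff.1 (hσ (Equiv.Perm.mem_support.2 h))).1
    have hcyc : (c * σ).cycleOf m = c := by
      rw [Equiv.Perm.cycleOf_mul_of_apply_right_eq_self hdisj.commute m hmσ, hc]
    simp only [hcyc, inv_mul_cancel_left]

theorem permM_of_isCycle {N : ℕ} {c : Equiv.Perm (Fin N)} (hc : c.IsCycle) :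
    permM c = cycleM c := by
  rw [permM, hc.cycleFactorsFinset_eq_singleton, Finset.sum_singleton]

theorem permM_one {N : ℕ} : permM (1 : Equiv.Perm (Fin N)) = 0 := by
  rw [permM, Equiv.Perm.cycleFactorsFinset_one, Finset.sum_empty]

theorem card_oddCyclesThrough {N : ℕ} (m : Fin N) (U : Finset (Fin N)) (hlt : ∀ x ∈ U, x < m)
    (e : ℕ) : ((oddCyclesThrough m U e).card : ℤ) = oddCycleCount (U.card + 1) e := by
  have hmU : m ∉ U := fun h => (hlt m h).false
  rcases U.eq_empty_or_nonempty with rfl | hU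
  · have hiff : ∀ c : Equiv.Perm (Fin N), (c.cycleOf m = c ∧ c.support.erase m = ∅ ∧
        Odd (orderOf c) ∧ permM c = e) ↔ c = 1 ∧ e = 0 := by
      intro c
      constructor
      · rintro ⟨-, hs, -, rfl⟩
        have : c = 1 := by
          rw [← Equiv.Perm.card_support_le_one]
          have := Finset.pred_card_le_card_erase (s := c.support) (a := m)
          rw [hs, Finset.card_empty] at this
          omega
        exact ⟨this, this ▸ permM_one⟩
      · rintro ⟨rfl, rfl⟩
        simp [permM_one]
    simp only [oddCyclesThrough, hiff]
    by_cases he : e = 0 <;> simp [oddCycleCount, he, Finset.filter_eq']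
  · have hiff : ∀ c : Equiv.Perm (Fin N), (c.cycleOf m = c ∧ c.support.erase m = U ∧
        Odd (orderOf c) ∧ permM c = e) ↔
          Odd (U.card + 1) ∧ (c.IsCycle ∧ c.support = insert m U) ∧ cycleM c = e := by
      intro c
      constructor
      · rintro ⟨hc, hs, ho, hM⟩
        have hcm : c m ≠ m := by
          intro h
          rw [(Equiv.Perm.cycleOf_eq_one_iff c).2 h] at hc
          rw [← hc] at hs
          simp [← hs] at hU
        have hcyc : c.IsCycle := hc ▸ Equiv.Perm.isCycle_cycleOf c hcm
        have hsupp : c.support = insert m U := by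
          rw [← hs, Finset.insert_erase (Equiv.Perm.mem_support.2 hcm)]
        rw [hcyc.orderOf, hsupp, Finset.card_insert_of_notMem hmU] at ho
        exact ⟨ho, ⟨hcyc, hsupp⟩, permM_of_isCycle hcyc ▸ hM⟩
      · rintro ⟨ho, ⟨hcyc, hsupp⟩, hM⟩
        refine ⟨hcyc.cycleOf_eq (Equiv.Perm.mem_support.1 (by simp [hsupp])), ?_, ?_, ?_⟩
        · rw [hsupp, Finset.erase_insert hmU]
        · rwa [hcyc.orderOf, hsupp, Finset.card_insert_of_notMem hmU]
        · rw [permM_of_isCycle hcyc, hM]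
    simp only [oddCyclesThrough, hiff]
    by_cases ho : Odd (U.card + 1)
    · simp only [ho, true_and]
      exact card_cycles_cycleM m U hU hlt ho e
    · simp [ho, oddCycleCount]

/-- The coefficient of `X ^ k / k!` in a power series. -/
noncomputable def egfCoeff (k : ℕ) : PowerSeries ℚ →ₗ[ℚ] ℚ :=
  (k.factorial : ℚ) • PowerSeries.coeff k

theorem egfCoeff_apply (k : ℕ) (f : PowerSeries ℚ) :
    egfCoeff k f = k.factorial * PowerSeries.coeff k f := rfl

theorem egfCoeff_C_mul (k : ℕ) (r : ℚ) (f : PowerSeries ℚ) :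
    egfCoeff k (PowerSeries.C r * f) = r * egfCoeff k f := by
  rw [egfCoeff_apply, egfCoeff_apply, PowerSeries.coeff_C_mul]
  ring

theorem egfCoeff_X_pow_mul (k j : ℕ) (f : PowerSeries ℚ) :
    egfCoeff k (PowerSeries.X ^ j * f) = k.descFactorial j * egfCoeff (k - j) f := by
  rw [egfCoeff_apply, egfCoeff_apply, PowerSeries.coeff_X_pow_mul']
  split_ifs with h
  · rw [← Nat.factorial_mul_descFactorial h]
    push_cast
    ring
  · rw [Nat.descFactorial_of_lt (not_le.1 h)]
    simp

theorem egfCoeff_exp_pow (k i : ℕ) : egfCoeff k (PowerSeries.exp ℚ ^ i) = (i : ℚ) ^ k := by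
  have : (k.factorial : ℚ) ≠ 0 := by positivity
  rw [egfCoeff_apply, PowerSeries.exp_pow_eq_rescale_exp, PowerSeries.coeff_rescale,
    PowerSeries.coeff_exp, Algebra.algebraMap_self_apply]
  field_simp

theorem egfCoeff_exp_neg_pow (k i : ℕ) :
    egfCoeff k (PowerSeries.evalNegHom (PowerSeries.exp ℚ) ^ i) = (-1) ^ k * (i : ℚ) ^ k := by
  rw [← egfCoeff_exp_pow k i, ← map_pow, PowerSeries.evalNegHom, egfCoeff_apply, egfCoeff_apply,
    PowerSeries.coeff_rescale]
  ring

theorem egfCoeff_derivative (k : ℕ) (f : PowerSeries ℚ) :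
    egfCoeff k (PowerSeries.derivative ℚ f) = egfCoeff (k + 1) f := by
  rw [egfCoeff_apply, egfCoeff_apply, PowerSeries.coeff_derivative, Nat.factorial_succ]
  push_cast
  ring

theorem egfCoeff_mul (n : ℕ) (f g : PowerSeries ℚ) :
    egfCoeff n (f * g) =
      ∑ k ∈ range (n + 1), n.choose k * (egfCoeff k f * egfCoeff (n - k) g) := by
  rw [egfCoeff_apply, PowerSeries.coeff_mul, Finset.mul_sum,
    Finset.Nat.sum_antidiagonal_eq_sum_range_succ_mk]
  refine Finset.sum_congr rfl fun k hk => ?_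
  have hk : k ≤ n := Nat.lt_succ_iff.1 (Finset.mem_range.1 hk)
  rw [← Nat.choose_mul_factorial_mul_factorial hk, egfCoeff_apply, egfCoeff_apply]
  push_cast
  ring

/-- The exponential generating function of the odd cycles `c` with `M(c) = e`. -/
noncomputable def oddCycleSeries (e : ℕ) : PowerSeries ℚ :=
  PowerSeries.mk fun k => (oddCycleCount k e : ℚ) / k.factorial

theorem egfCoeff_oddCycleSeries (k e : ℕ) :
    egfCoeff k (oddCycleSeries e) = oddCycleCount k e := by
  have : (k.factorial : ℚ) ≠ 0 := by positivity
  rw [egfCoeff_apply, oddCycleSeries, PowerSeries.coeff_mk]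
  field_simp

theorem ext_egfCoeff {f g : PowerSeries ℚ} (h : ∀ k, egfCoeff k f = egfCoeff k g) : f = g := by
  ext k
  have : (k.factorial : ℚ) ≠ 0 := by positivity
  exact mul_left_cancel₀ this (h k)

/-- The exponential generating function of the odd order permutations `π` with `M(π) = d`, where
`d ≤ 3`. -/
noncomputable def oddPermSeries : ℕ → PowerSeries ℚ
  | 0 => PowerSeries.exp ℚ
  | 1 => PowerSeries.exp ℚ * oddCycleSeries 1
  | 2 => PowerSeries.exp ℚ *
      (oddCycleSeries 2 + PowerSeries.C (1 / 2) * oddCycleSeries 1 ^ 2)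
  | 3 => PowerSeries.exp ℚ *
      (oddCycleSeries 3 + oddCycleSeries 1 * oddCycleSeries 2
        + PowerSeries.C (1 / 6) * oddCycleSeries 1 ^ 3)
  | _ => 0

theorem egfCoeff_X_pow (k j : ℕ) :
    egfCoeff k (PowerSeries.X ^ j) = if k = j then (k.factorial : ℚ) else 0 := by
  rw [egfCoeff_apply, PowerSeries.coeff_X_pow]
  simp

theorem oddCycleSeries_zero : oddCycleSeries 0 = PowerSeries.X := by
  refine ext_egfCoeff fun k => ?_
  rw [egfCoeff_oddCycleSeries, ← pow_one PowerSeries.X, egfCoeff_X_pow, oddCycleCount]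
  by_cases hk : k = 1 <;> simp [hk]

theorem derivative_oddPermSeries {d : ℕ} (hd : d ≤ 3) :
    PowerSeries.derivative ℚ (oddPermSeries d) = ∑ ij ∈ antidiagonal d,
      PowerSeries.derivative ℚ (oddCycleSeries ij.1) * oddPermSeries ij.2 := by
  have h2 : 2 * PowerSeries.C (1 / 2 : ℚ) = 1 := by
    rw [← map_ofNat PowerSeries.C 2, ← map_mul]
    norm_num
  have h3 : 3 * PowerSeries.C (1 / 6 : ℚ) = PowerSeries.C (1 / 2 : ℚ) := by
    rw [← map_ofNat PowerSeries.C 3, ← map_mul]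
    norm_num
  have hexp := PowerSeries.derivative_exp ℚ
  interval_cases d <;>
    simp only [Finset.Nat.antidiagonal_succ, Finset.Nat.antidiagonal_zero, Finset.map_singleton,
      Finset.sum_cons, Finset.sum_singleton, Finset.map_cons,
      Function.Embedding.prodMap, Function.Embedding.coeFn_mk, Prod.map, oddPermSeries,
      Nat.succ_eq_add_one, Function.Embedding.refl_apply, oddCycleSeries_zero,
      PowerSeries.derivative_X, Derivation.leibniz, Derivation.leibniz_pow, map_add, hexp,
      PowerSeries.derivative_C, smul_eq_mul, nsmul_eq_mul, Nat.cast_ofNat, zero_add,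
      Nat.reduceAdd, Nat.reduceSub, pow_one, mul_zero, add_zero, one_mul]
  · ring
  · linear_combination (PowerSeries.exp ℚ * oddCycleSeries 1
      * PowerSeries.derivative ℚ (oddCycleSeries 1)) * h2
  · linear_combination (PowerSeries.exp ℚ * oddCycleSeries 1 ^ 2
      * PowerSeries.derivative ℚ (oddCycleSeries 1)) * h3

theorem egfCoeff_oddPermSeries_succ (n : ℕ) {d : ℕ} (hd : d ≤ 3) :
    egfCoeff (n + 1) (oddPermSeries d) = ∑ k ∈ range (n + 1), n.choose k *
      ∑ ij ∈ antidiagonal d, oddCycleCount (k + 1) ij.1 * egfCoeff (n - k) (oddPermSeries ij.2) := by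
  rw [← egfCoeff_derivative, derivative_oddPermSeries hd, map_sum]
  simp only [egfCoeff_mul, egfCoeff_derivative, egfCoeff_oddCycleSeries, Finset.mul_sum]
  exact Finset.sum_comm

theorem oddPerms_empty {N : ℕ} (d : ℕ) :
    (oddPerms (∅ : Finset (Fin N)) d).card = if d = 0 then 1 else 0 := by
  have hiff : ∀ π : Equiv.Perm (Fin N),
      (π.support ⊆ ∅ ∧ Odd (orderOf π) ∧ permM π = d) ↔ π = 1 ∧ d = 0 := by
    intro π
    rw [Finset.subset_empty, Equiv.Perm.support_eq_empty_iff]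
    constructor
    · rintro ⟨rfl, -, rfl⟩
      exact ⟨rfl, permM_one⟩
    · rintro ⟨rfl, rfl⟩
      simp [permM_one]
  simp only [oddPerms, hiff]
  by_cases hd : d = 0 <;> simp [hd, Finset.filter_eq']

theorem card_oddPerms {N : ℕ} (S : Finset (Fin N)) {d : ℕ} (hd : d ≤ 3) :
    ((oddPerms S d).card : ℚ) = egfCoeff S.card (oddPermSeries d) := by
  induction hn : S.card using Nat.strong_induction_on generalizing S d with
  | _ n ih =>
  rcases S.eq_empty_or_nonempty with rfl | hS
  · obtain rfl : n = 0 := by simpa using hn.symm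
    have hA : ∀ e, PowerSeries.constantCoeff (oddCycleSeries e) = 0 := fun e => by
      simp [oddCycleSeries, oddCycleCount, ← PowerSeries.coeff_zero_eq_constantCoeff_apply]
    rw [oddPerms_empty]
    interval_cases d <;> simp [egfCoeff_apply, oddPermSeries, hA]
  · set m := S.max' hS
    set T := S.erase m
    have hmS : m ∈ S := S.max'_mem hS
    have hlt : ∀ x ∈ T, x < m := fun x hx => S.lt_max'_of_mem_erase_max' hS hx
    have hcard : n = T.card + 1 := by rw [← hn, Finset.card_erase_add_one hmS]
    rw [← Finset.insert_erase hmS, card_oddPerms_insert m T (Finset.notMem_erase m S) d, hcard,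
      egfCoeff_oddPermSeries_succ _ hd]
    push_cast
    have hterm : ∀ U ∈ T.powerset, (∑ ij ∈ antidiagonal d,
        ((oddCyclesThrough m U ij.1).card : ℚ) * (oddPerms (T \ U) ij.2).card) =
        ∑ ij ∈ antidiagonal d, oddCycleCount (U.card + 1) ij.1 *
          egfCoeff (T.card - U.card) (oddPermSeries ij.2) := by
      intro U hU
      have hU := Finset.mem_powerset.1 hU
      refine Finset.sum_congr rfl fun ij hij => ?_
      have hij := HasAntidiagonal.mem_antidiagonal.1 hij
      have hsd : (T \ U).card = T.card - U.card := Finset.card_sdiff_of_subset hU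
      rw [ih (T.card - U.card) (by omega) (T \ U) (by omega) hsd,
        ← card_oddCyclesThrough m U (fun x hx => hlt x (hU hx)) ij.1]
      norm_cast
    rw [Finset.sum_congr rfl hterm, Finset.sum_powerset_apply_card fun k =>
      ∑ ij ∈ antidiagonal d, (oddCycleCount (k + 1) ij.1 : ℚ) *
        egfCoeff (T.card - k) (oddPermSeries ij.2)]
    simp only [nsmul_eq_mul]

theorem oddCycleSeries_one :
    oddCycleSeries 1 = PowerSeries.exp ℚ ^ 1 - PowerSeries.evalNegHom (PowerSeries.exp ℚ) ^ 1
      - PowerSeries.C 2 * PowerSeries.X ^ 1 := by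
  refine ext_egfCoeff fun k => ?_
  simp only [egfCoeff_oddCycleSeries, map_sub, egfCoeff_C_mul, egfCoeff_X_pow, egfCoeff_exp_pow,
    egfCoeff_exp_neg_pow, oddCycleCount]
  rcases Nat.even_or_odd k with hk | hk
  · have h1 : k ≠ 1 := by
      rintro rfl
      exact absurd hk (by decide)
    simp [hk.neg_one_pow, Nat.not_odd_iff_even.2 hk, h1]
  · obtain rfl | h1 := eq_or_ne k 1
    · norm_num
    · have h2 : 2 < k := by
        obtain ⟨r, rfl⟩ := hk
        omega
      simp [hk.neg_one_pow, hk, h1, h2, eulerianRec_zero]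
      norm_num

theorem oddCycleSeries_two :
    oddCycleSeries 2 = PowerSeries.C (1 / 2) *
        (PowerSeries.exp ℚ ^ 2 - PowerSeries.evalNegHom (PowerSeries.exp ℚ) ^ 2)
      - PowerSeries.X ^ 1 *
        (PowerSeries.exp ℚ ^ 1 + PowerSeries.evalNegHom (PowerSeries.exp ℚ) ^ 1)
      - PowerSeries.C (1 / 3) * PowerSeries.X ^ 3 := by
  refine ext_egfCoeff fun k => ?_
  simp only [egfCoeff_oddCycleSeries, map_sub, map_add, egfCoeff_C_mul, egfCoeff_X_pow_mul,
    egfCoeff_X_pow, egfCoeff_exp_pow, egfCoeff_exp_neg_pow, oddCycleCount]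
  rcases k with _ | k
  · simp
  rcases Nat.even_or_odd (k + 1) with hk | hk
  · have h3 : k + 1 ≠ 3 := by
      intro h
      rw [h] at hk
      exact absurd hk (by decide)
    have hk' : Odd k := by
      rw [Nat.even_add_one, Nat.not_even_iff_odd] at hk
      exact hk
    simp only [hk.neg_one_pow, Nat.not_odd_iff_even.2 hk, h3, if_false, Nat.add_sub_cancel,
      hk'.neg_one_pow]
    simp
  · have hk' : Even k := by
      rw [Nat.odd_add_one, Nat.not_odd_iff_even] at hk
      exact hk
    by_cases h4 : 4 < k + 1
    · have h3 : k + 1 ≠ 3 := by omega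
      simp only [hk.neg_one_pow, hk, h3, h4, if_true, if_false, Nat.add_sub_cancel,
        hk'.neg_one_pow, eulerianRec_one, Nat.reduceMul, Nat.reduceSub, two_ne_zero]
      simp
      ring
    · obtain rfl | rfl : k = 0 ∨ k = 2 := by
        obtain ⟨r, rfl⟩ := hk'
        omega
      · norm_num [Nat.descFactorial]
      · norm_num [Nat.descFactorial, Nat.factorial]

theorem oddCycleSeries_three :
    oddCycleSeries 3 = PowerSeries.C (1 / 3) *
        (PowerSeries.exp ℚ ^ 3 - PowerSeries.evalNegHom (PowerSeries.exp ℚ) ^ 3)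
      - PowerSeries.X ^ 1 *
        (PowerSeries.exp ℚ ^ 2 + PowerSeries.evalNegHom (PowerSeries.exp ℚ) ^ 2)
      + PowerSeries.C (1 / 2) * (PowerSeries.X ^ 2 *
        (PowerSeries.exp ℚ ^ 1 - PowerSeries.evalNegHom (PowerSeries.exp ℚ) ^ 1))
      - PowerSeries.C (11 / 60) * PowerSeries.X ^ 5 := by
  refine ext_egfCoeff fun k => ?_
  simp only [egfCoeff_oddCycleSeries, map_sub, map_add, egfCoeff_C_mul, egfCoeff_X_pow_mul,
    egfCoeff_X_pow, egfCoeff_exp_pow, egfCoeff_exp_neg_pow, oddCycleCount]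
  rcases k with _ | _ | k
  · simp
  · norm_num [Nat.descFactorial]
  rcases Nat.even_or_odd k with hk | hk
  · have h5 : k + 2 ≠ 5 := by
      obtain ⟨r, rfl⟩ := hk
      omega
    have hk1 : Odd (k + 1) := hk.add_one
    have hk2 : Even (k + 2) := hk1.add_one
    simp only [hk.neg_one_pow, Nat.not_odd_iff_even.2 hk2, h5, if_false, Nat.add_sub_cancel,
      hk1.neg_one_pow, hk2.neg_one_pow, Nat.reduceSubDiff]
    simp
  · have hk1 : Even (k + 1) := hk.add_one
    have hk2 : Odd (k + 2) := hk1.add_one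
    by_cases h6 : 6 < k + 2
    · have h5 : k + 2 ≠ 5 := by omega
      simp only [hk.neg_one_pow, hk2, h5, h6, if_false, if_true, Nat.add_sub_cancel,
        hk1.neg_one_pow, hk2.neg_one_pow, Nat.reduceSubDiff, Nat.reduceMul,
        three_ne_zero, Int.cast_mul, eulerianRec_two, Nat.descFactorial, Nat.sub_zero]
      push_cast
      ring
    · obtain rfl | rfl : k = 1 ∨ k = 3 := by
        obtain ⟨r, rfl⟩ := hk
        omega
      · norm_num [Nat.descFactorial, Nat.factorial]
      · norm_num [Nat.descFactorial, Nat.factorial]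

theorem oddPermSeries_three :
    oddPermSeries 3 = PowerSeries.exp ℚ ^ 4
      - PowerSeries.C 4 * (PowerSeries.X ^ 1 * PowerSeries.exp ℚ ^ 3)
      - PowerSeries.exp ℚ ^ 2
      + PowerSeries.C (9 / 2) * (PowerSeries.X ^ 2 * PowerSeries.exp ℚ ^ 2)
      - PowerSeries.C (1 / 2) * PowerSeries.X ^ 2
      + PowerSeries.C 2 * (PowerSeries.X ^ 1 * PowerSeries.exp ℚ ^ 1)
      - PowerSeries.C (1 / 3) * (PowerSeries.X ^ 3 * PowerSeries.exp ℚ ^ 2)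
      + PowerSeries.C (1 / 3) * PowerSeries.X ^ 3
      + PowerSeries.C (2 / 3) * (PowerSeries.X ^ 4 * PowerSeries.exp ℚ ^ 1)
      - PowerSeries.C (4 / 3) * (PowerSeries.X ^ 3 * PowerSeries.exp ℚ ^ 1)
      - PowerSeries.C (11 / 60) * (PowerSeries.X ^ 5 * PowerSeries.exp ℚ ^ 1) := by
  have hC : ∀ (a : ℕ) (r : ℚ), r = a * (1 / 60) →
      PowerSeries.C r = (a : PowerSeries ℚ) * PowerSeries.C (1 / 60) := by
    rintro a r rfl
    rw [map_mul, map_natCast]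
  have hc : 60 * PowerSeries.C (1 / 60 : ℚ) = 1 := by
    rw [← map_ofNat PowerSeries.C 60, ← map_mul]
    norm_num
  rw [oddPermSeries, oddCycleSeries_one, oddCycleSeries_two, oddCycleSeries_three,
    hC 10 (1 / 6) (by norm_num), hC 20 (1 / 3) (by norm_num), hC 30 (1 / 2) (by norm_num),
    hC 11 (11 / 60) (by norm_num), hC 270 (9 / 2) (by norm_num), hC 40 (2 / 3) (by norm_num),
    hC 80 (4 / 3) (by norm_num), hC 120 2 (by norm_num), hC 240 4 (by norm_num)]
  have hEF := PowerSeries.exp_mul_exp_neg_eq_one (A := ℚ)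
  generalize PowerSeries.C (1 / 60 : ℚ) = c at *
  generalize PowerSeries.evalNegHom (PowerSeries.exp ℚ) = F at *
  generalize PowerSeries.exp ℚ = E at *
  generalize (PowerSeries.X : PowerSeries ℚ) = Y at *
  push_cast
  grind

theorem cast_choose_three (n : ℕ) : (n.choose 3 : ℚ) = n * (n - 1) * (n - 2) / 6 := by
  induction n with
  | zero => simp
  | succ n ih =>
    rw [Nat.choose_succ_succ' n 2]
    push_cast
    rw [ih, Nat.cast_choose_two]
    ring

theorem pCount_eq_card_oddPerms (n d : ℕ) :
    pCount n d = (oddPerms (univ : Finset (Fin n)) d).card := by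
  simp [pCount, oddPerms]

theorem odd_order_three_descents (n : ℕ) (hn : 4 ≤ n) :
    (pCount n 3 : ℤ) =
      4 * eulerianNum (n - 1) 3 - ((n.choose 3 : ℤ) - n.choose 2 + 4) * 2 ^ (n - 2)
        - 22 * n.choose 5 + 16 * n.choose 4 - 4 * n.choose 3 + 2 * n := by
  have hp : (pCount n 3 : ℚ) = egfCoeff n (oddPermSeries 3) := by
    rw [pCount_eq_card_oddPerms, card_oddPerms univ le_rfl, Finset.card_univ, Fintype.card_fin]
  have h2 : n ≠ 2 := by omega
  have h3 : n ≠ 3 := by omega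
  simp only [oddPermSeries_three, map_sub, map_add, egfCoeff_C_mul, egfCoeff_X_pow_mul,
    egfCoeff_X_pow, egfCoeff_exp_pow, h2, h3, if_false, Nat.descFactorial_eq_factorial_mul_choose]
    at hp
  rw [eulerianNum_eq_eulerianRec]
  have hE := eulerianRec_three (n - 1)
  have c2 := Nat.cast_choose_two ℚ n
  have c3 := cast_choose_three n
  obtain ⟨m, rfl⟩ := Nat.exists_eq_add_of_le' hn
  simp only [show m + 4 - 1 = m + 3 by omega, show m + 4 - 2 = m + 2 by omega,
    show m + 4 - 3 = m + 1 by omega, Nat.choose_one_right, Nat.factorial] at hp hE ⊢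
  suffices h : (pCount (m + 4) 3 : ℚ) =
      4 * eulerianRec (m + 3) 3 - (((m + 4).choose 3 : ℚ) - (m + 4).choose 2 + 4) * 2 ^ (m + 2)
        - 22 * (m + 4).choose 5 + 16 * (m + 4).choose 4 - 4 * (m + 4).choose 3 + 2 * (m + 4 : ℕ) by
    exact_mod_cast h
  rw [hp, hE]
  push_cast at c2 c3 ⊢
  rw [c2, c3]
  ring
end

section
/- For all n ≥ 2, the number of permutations π of {1,…,n} such that positions 1 and 2 are both ascents and positions 3, 4, …, n−1 contain exactly one descent, equals 2^{n} − n²/2 − (3/2)·n + 1. -/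
open Finset
open scoped Classical

/-- `f(00,n)`: the number of permutations of `{1,…,n}` whose first two positions are
ascents and whose remaining positions contain exactly one descent.  (Positions are
0-indexed here; the paper's positions `1,2` and `3,…,n-1` correspond to `0,1` and
`2,…,n-2`.) -/
noncomputable def f00Count (n : ℕ) : ℕ :=
  (Finset.univ.filter fun π : Equiv.Perm (Fin n) =>
    0 ∈ ascentSet (permWord π) ∧ 1 ∈ ascentSet (permWord π) ∧
      ((descentSet (permWord π)).filter fun i => 2 ≤ i).card = 1).card

theorem mem_ascentSet_permWord {n : ℕ} (π : Equiv.Perm (Fin n)) (i : ℕ) :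
    i ∈ ascentSet (permWord π) ↔
      ∃ h : i + 1 < n, π ⟨i, by omega⟩ < π ⟨i + 1, h⟩ := by
  by_cases h : i + 1 < n
  · have h' : i < n := by omega
    have h'' : i < n - 1 := by omega
    simp [ascentSet, permWord, h, h', h'', List.getD_eq_getElem?_getD]
  · have h'' : ¬ i < n - 1 := by omega
    simp [ascentSet, permWord, h, h'']

theorem mem_descentSet_permWord {n : ℕ} (π : Equiv.Perm (Fin n)) (i : ℕ) :
    i ∈ descentSet (permWord π) ↔
      ∃ h : i + 1 < n, π ⟨i + 1, h⟩ < π ⟨i, by omega⟩ := by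
  by_cases h : i + 1 < n
  · have h' : i < n := by omega
    have h'' : i < n - 1 := by omega
    simp [descentSet, permWord, h, h', h'', List.getD_eq_getElem?_getD]
  · have h'' : ¬ i < n - 1 := by omega
    simp [descentSet, permWord, h, h'']

/-- If no position of `[a, b)` is a descent, then `π` is increasing from `a` to `b`. -/
theorem lt_of_forall_notMem_descentSet {n : ℕ} (π : Equiv.Perm (Fin n)) {a b : Fin n}
    (hab : a < b)
    (h : ∀ m : ℕ, (a : ℕ) ≤ m → m < b → m ∉ descentSet (permWord π)) : π a < π b := by
  obtain ⟨b, hb⟩ := b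
  have key : ∀ c : ℕ, (a : ℕ) + 1 ≤ c → ∀ hc : c < n, c ≤ b → π a < π ⟨c, hc⟩ := by
    have step : ∀ m (hm : m + 1 < n), (a : ℕ) ≤ m → m < b →
        π ⟨m, by omega⟩ < π ⟨m + 1, hm⟩ := by
      intro m hm ham hmb
      have hd := h m ham hmb
      rw [mem_descentSet_permWord] at hd
      refine lt_of_le_of_ne (not_lt.mp fun hlt => hd ⟨hm, hlt⟩) fun he => ?_
      have := congrArg Fin.val (π.injective he)
      simp at this
    intro c hac
    induction c, hac using Nat.le_induction with
    | base => intro hc hcb; exact step a hc le_rfl (by omega)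
    | succ c hac ih =>
      intro hc hcb
      exact (ih (by omega) (by omega)).trans (step c hc (by omega) (by omega))
  exact key b hab hb le_rfl

theorem card_filter_val_lt {n k : ℕ} (hk : k ≤ n) :
    (univ.filter fun i : Fin n => (i : ℕ) < k).card = k := by
  rw [Fin.card_filter_val_lt]; omega

/-- A lower set of `Fin n` is the initial segment of its cardinality. -/
theorem mem_iff_lt_card_of_isLowerSet {n : ℕ} {S : Finset (Fin n)}
    (hS : IsLowerSet (S : Set (Fin n))) (i : Fin n) : i ∈ S ↔ (i : ℕ) < S.card := by
  constructor
  · intro hi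
    have hsub : Finset.Iic i ⊆ S := fun j hj => hS (Finset.mem_Iic.mp hj) hi
    have := Finset.card_le_card hsub
    rw [Fin.card_Iic] at this
    omega
  · intro hi
    by_contra hni
    have hsub : S ⊆ Finset.Iio i := fun j hj =>
      Finset.mem_Iio.mpr (lt_of_not_ge fun hij => hni (hS hij hj))
    have := Finset.card_le_card hsub
    rw [Fin.card_Iio] at this
    omega

/-- The permutation whose word lists the elements of `S` increasingly, followed by the
elements of the complement of `S` increasingly. -/
noncomputable def shufflePerm {n : ℕ} (S : Finset (Fin n)) : Equiv.Perm (Fin n) :=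
  Tuple.sort fun x => if x ∈ S then 0 else 1

theorem eq_shufflePerm_iff {n : ℕ} (S : Finset (Fin n)) (π : Equiv.Perm (Fin n)) :
    π = shufflePerm S ↔
      (∀ i j, i ≤ j → π j ∈ S → π i ∈ S) ∧
        ∀ i j, i < j → (π i ∈ S ↔ π j ∈ S) → π i < π j := by
  rw [shufflePerm, Tuple.eq_sort_iff]
  refine and_congr ?_ ?_
  · refine forall_congr' fun i => forall_congr' fun j => imp_congr_right fun _ => ?_
    by_cases hi : π i ∈ S <;> by_cases hj : π j ∈ S <;> simp [hi, hj]
  · refine forall_congr' fun i => forall_congr' fun j => imp_congr_right fun _ => ?_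
    by_cases hi : π i ∈ S <;> by_cases hj : π j ∈ S <;> simp [hi, hj]

theorem shufflePerm_mem_iff {n : ℕ} (S : Finset (Fin n)) (i : Fin n) :
    shufflePerm S i ∈ S ↔ (i : ℕ) < S.card := by
  have h := ((eq_shufflePerm_iff S _).mp rfl).1
  have hl : IsLowerSet
      ((S.map (shufflePerm S).symm.toEmbedding : Finset (Fin n)) : Set (Fin n)) := by
    intro a b hba ha
    simp only [Finset.mem_coe, Finset.mem_map_equiv, Equiv.symm_symm] at ha ⊢
    exact h b a hba ha
  have := mem_iff_lt_card_of_isLowerSet hl i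
  rwa [Finset.mem_map_equiv, Finset.card_map, Equiv.symm_symm] at this

theorem descentSet_shufflePerm {n : ℕ} {S : Finset (Fin n)}
    (hS : ¬ IsLowerSet (S : Set (Fin n))) :
    descentSet (permWord (shufflePerm S)) = {S.card - 1} := by
  have hinc := ((eq_shufflePerm_iff S _).mp rfl).2
  have hsub : descentSet (permWord (shufflePerm S)) ⊆ {S.card - 1} := by
    intro i hi
    obtain ⟨h, hlt⟩ := (mem_descentSet_permWord _ _).mp hi
    rw [Finset.mem_singleton]
    by_contra hne
    refine (hinc ⟨i, by omega⟩ ⟨i + 1, h⟩ (by simp [Fin.lt_def]) ?_).asymm hlt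
    rw [shufflePerm_mem_iff, shufflePerm_mem_iff]
    simp only
    omega
  refine (Finset.subset_singleton_iff.mp hsub).resolve_left fun hempty => hS ?_
  have hmono : StrictMono (shufflePerm S) := fun a b hab =>
    lt_of_forall_notMem_descentSet _ hab (by simp [hempty])
  intro a b hba ha
  have ha' : shufflePerm S ((shufflePerm S).symm a) ∈ S := by simpa using ha
  have hb' : shufflePerm S ((shufflePerm S).symm b) ∈ S := by
    rw [shufflePerm_mem_iff] at ha' ⊢
    have : (shufflePerm S).symm b ≤ (shufflePerm S).symm a := by
      rw [← hmono.le_iff_le]; simpa using hba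
    exact lt_of_le_of_lt this ha'
  simpa using hb'

theorem shufflePerm_injOn {n : ℕ} {S T : Finset (Fin n)}
    (hS : ¬ IsLowerSet (S : Set (Fin n))) (hT : ¬ IsLowerSet (T : Set (Fin n)))
    (hST : shufflePerm S = shufflePerm T) : S = T := by
  have hpos : ∀ U : Finset (Fin n), ¬ IsLowerSet (U : Set (Fin n)) → 0 < U.card := by
    intro U hU
    refine Finset.card_pos.mpr (Finset.nonempty_iff_ne_empty.mpr ?_)
    rintro rfl
    exact hU (by simpa using isLowerSet_empty)
  have hd := descentSet_shufflePerm hS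
  rw [hST, descentSet_shufflePerm hT, Finset.singleton_inj] at hd
  have hcard : S.card = T.card := by
    have := hpos S hS
    have := hpos T hT
    omega
  ext x
  have h1 := shufflePerm_mem_iff S ((shufflePerm S).symm x)
  have h2 := shufflePerm_mem_iff T ((shufflePerm S).symm x)
  rw [← hST, ← hcard] at h2
  simpa using h1.trans h2.symm

theorem exists_shufflePerm_eq {n d : ℕ} {π : Equiv.Perm (Fin n)}
    (hd : descentSet (permWord π) = {d}) :
    ∃ S : Finset (Fin n), S.card = d + 1 ∧ ¬ IsLowerSet (S : Set (Fin n)) ∧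
      shufflePerm S = π := by
  obtain ⟨hdn, hlt⟩ := (mem_descentSet_permWord π d).mp (by simp [hd])
  set S : Finset (Fin n) :=
    (univ.filter fun i : Fin n => (i : ℕ) < d + 1).map π.toEmbedding with hS
  have hmem : ∀ i, π i ∈ S ↔ (i : ℕ) < d + 1 := by
    intro i
    simp [hS]
  refine ⟨S, ?_, ?_, ?_⟩
  · rw [hS, Finset.card_map, card_filter_val_lt hdn.le]
  · intro hl
    have h1 : π ⟨d, by omega⟩ ∈ S := (hmem _).mpr (by simp)
    have h2 := (hmem _).mp (hl hlt.le h1)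
    simp at h2
  · refine ((eq_shufflePerm_iff S π).mpr ⟨?_, ?_⟩).symm
    · intro i j hij hj
      rw [hmem] at hj ⊢
      exact lt_of_le_of_lt hij hj
    · intro i j hij h
      rw [hmem, hmem] at h
      refine lt_of_forall_notMem_descentSet π hij fun m him hmj => ?_
      rw [hd, Finset.mem_singleton]
      omega

theorem f00_condition_iff {n : ℕ} (π : Equiv.Perm (Fin n)) :
    (0 ∈ ascentSet (permWord π) ∧ 1 ∈ ascentSet (permWord π) ∧
      ((descentSet (permWord π)).filter fun i => 2 ≤ i).card = 1) ↔
      ∃ d, 2 ≤ d ∧ descentSet (permWord π) = {d} := by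
  constructor
  · rintro ⟨h0, h1, h⟩
    have hfil : (descentSet (permWord π)).filter (fun i => 2 ≤ i) =
        descentSet (permWord π) := by
      refine Finset.filter_true_of_mem fun i hi => ?_
      obtain ⟨_, hlt⟩ := (mem_descentSet_permWord π i).mp hi
      by_contra hi2
      obtain rfl | rfl : i = 0 ∨ i = 1 := by omega
      · obtain ⟨_, h⟩ := (mem_ascentSet_permWord π 0).mp h0
        exact h.asymm hlt
      · obtain ⟨_, h⟩ := (mem_ascentSet_permWord π 1).mp h1
        exact h.asymm hlt
    obtain ⟨d, hd⟩ := Finset.card_eq_one.mp h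
    have hd2 : d ∈ (descentSet (permWord π)).filter fun i => 2 ≤ i := by simp [hd]
    exact ⟨d, (Finset.mem_filter.mp hd2).2, hfil ▸ hd⟩
  · rintro ⟨d, hd2, hd⟩
    obtain ⟨hdn, -⟩ := (mem_descentSet_permWord π d).mp (by simp [hd])
    have hasc : ∀ i < d, i ∈ ascentSet (permWord π) := by
      intro i hi
      refine (mem_ascentSet_permWord π i).mpr ⟨by omega, ?_⟩
      refine lt_of_forall_notMem_descentSet π (by simp [Fin.lt_def]) fun m h1 h2 => ?_
      simp only at h1 h2
      rw [hd, Finset.mem_singleton]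
      omega
    refine ⟨hasc 0 (by omega), hasc 1 (by omega), ?_⟩
    rw [hd, Finset.filter_singleton, if_pos hd2, Finset.card_singleton]

theorem f00Count_eq_card_finsets (n : ℕ) :
    f00Count n = (univ.filter fun S : Finset (Fin n) =>
      3 ≤ S.card ∧ ¬ IsLowerSet (S : Set (Fin n))).card := by
  symm
  refine Finset.card_bij (fun S _ => shufflePerm S) ?_ ?_ ?_
  · intro S hS
    obtain ⟨hc, hl⟩ := (Finset.mem_filter.mp hS).2
    exact Finset.mem_filter.mpr ⟨Finset.mem_univ _,
      (f00_condition_iff _).mpr ⟨_, by omega, descentSet_shufflePerm hl⟩⟩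
  · intro S hS T hT h
    exact shufflePerm_injOn (Finset.mem_filter.mp hS).2.2 (Finset.mem_filter.mp hT).2.2 h
  · intro π hπ
    obtain ⟨d, hd2, hd⟩ := (f00_condition_iff π).mp (Finset.mem_filter.mp hπ).2
    obtain ⟨S, hc, hl, hSπ⟩ := exists_shufflePerm_eq hd
    exact ⟨S, Finset.mem_filter.mpr ⟨Finset.mem_univ _, by omega, hl⟩, hSπ⟩

theorem card_isLowerSet_filter (n : ℕ) :
    (univ.filter fun S : Finset (Fin n) =>
      3 ≤ S.card ∧ IsLowerSet (S : Set (Fin n))).card = n - 2 := by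
  trans (Finset.Icc 3 n).card
  · refine Finset.card_nbij' Finset.card
      (fun k => univ.filter fun i : Fin n => (i : ℕ) < k) ?_ ?_ ?_ ?_
    · intro S hS
      have := card_finset_fin_le S
      simp_all
    · intro k hk
      obtain ⟨h3, hkn⟩ := Finset.mem_Icc.mp hk
      refine Finset.mem_coe.mpr (Finset.mem_filter.mpr ⟨Finset.mem_univ _, ?_, ?_⟩)
      · rwa [card_filter_val_lt hkn]
      · intro a b hba ha
        simp only [Finset.coe_filter, Finset.mem_univ, true_and, Set.mem_ofPred_eq] at ha ⊢
        exact lt_of_le_of_lt hba ha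
    · intro S hS
      ext i
      simp [mem_iff_lt_card_of_isLowerSet (Finset.mem_filter.mp hS).2.2 i]
    · intro k hk
      exact card_filter_val_lt (Finset.mem_Icc.mp hk).2
  · rw [Nat.card_Icc]; omega

theorem card_filter_card_lt_three (n : ℕ) :
    (univ.filter fun S : Finset (Fin n) => ¬ 3 ≤ S.card).card = 1 + n + n.choose 2 := by
  have hmaps : ∀ S ∈ univ.filter fun S : Finset (Fin n) => ¬ 3 ≤ S.card,
      S.card ∈ Finset.range 3 := by
    intro S hS
    simpa using hS
  rw [Finset.card_eq_sum_card_fiberwise hmaps]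
  have hfib : ∀ k ∈ Finset.range 3,
      ((univ.filter fun S : Finset (Fin n) => ¬ 3 ≤ S.card).filter
        fun S => S.card = k).card = n.choose k := by
    intro k hk
    rw [Finset.mem_range] at hk
    trans (Finset.powersetCard k (univ : Finset (Fin n))).card
    swap
    · simp
    congr 1
    ext S
    simp only [Finset.mem_filter, Finset.mem_univ, true_and, Finset.mem_powersetCard,
      Finset.subset_univ]
    omega
  rw [Finset.sum_congr rfl hfib]
  simp [Finset.sum_range_succ]

theorem f00_formula (n : ℕ) (hn : 2 ≤ n) :
    (f00Count n : ℚ) =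
      2 ^ n - (n : ℚ) ^ 2 / 2 - (3 / 2) * (n : ℚ) + 1 := by
  have hsplit := Finset.card_filter_add_card_filter_not (s := univ)
    (fun S : Finset (Fin n) => 3 ≤ S.card)
  have hlower := Finset.card_filter_add_card_filter_not
    (s := univ.filter fun S : Finset (Fin n) => 3 ≤ S.card)
    (fun S : Finset (Fin n) => IsLowerSet (S : Set (Fin n)))
  rw [Finset.filter_filter, Finset.filter_filter, card_isLowerSet_filter,
    ← f00Count_eq_card_finsets] at hlower
  rw [card_filter_card_lt_three, ← hlower, Finset.card_univ, Fintype.card_finset,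
    Fintype.card_fin] at hsplit
  have hq : ((n - 2 : ℕ) : ℚ) + f00Count n + (1 + n + (n.choose 2 : ℕ)) = 2 ^ n := by
    exact_mod_cast hsplit
  rw [Nat.cast_choose_two, Nat.cast_sub hn] at hq
  push_cast at hq
  linarith
end
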